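/- In the setting of the Kahan–Hirota–Kimura discretization of the vector field f defined by wᵀf(x)=det(w,v₁,…,v_{n−3}, ℓ₂a₁+ℓ₁a₂, ℓ₄a₃+ℓ₃a₄) (with ℓ₁,ℓ₂,ℓ₃,ℓ₄ linear forms ℓᵢ(x)=aᵢᵀx on ℝⁿ and v₁,…,v_{n−3}∈ℝⁿ), for any x,x̃∈ℝⁿ satisfying the Kahan–Hirota–Kimura relation one has the determinant identity det(I+εf'(x̃)) · ℓ₁(x)ℓ₂(x)ℓ₃(x)ℓ₄(x) = det(I−εf'(x)) · ℓ₁(x̃)ℓ₂(x̃)ℓ₃(x̃)ℓ₄(x̃), where f'(x) is the Jacobian matrix of f. Consequently the Jacobian determinant of the Kahan–Hirota–Kimura map equals ℓ₁(x̃)ℓ₂(x̃)ℓ₃(x̃)ℓ₄(x̃)/(ℓ₁(x)ℓ₂(x)ℓ₃(x)ℓ₄(x)), i.e. the map preserves the measure form dx₁∧…∧dxₙ/(ℓ₁ℓ₂ℓ₃ℓ₄). -/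

import Mathlib

open Matrix

/-- `colDet w v u₁ u₂` is the determinant of the `n×n` matrix (`n = m+3`) whose
columns are `w, v 0, …, v (m−1), u₁, u₂`, in this order. -/
def colDet {m : ℕ} (w : Fin (m + 3) → ℝ) (v : Fin m → Fin (m + 3) → ℝ)
    (u₁ u₂ : Fin (m + 3) → ℝ) : ℝ :=
  Matrix.det (Matrix.of fun i j =>
    (Fin.cons w (Fin.snoc (Fin.snoc v u₁) u₂) : Fin (m + 3) → Fin (m + 3) → ℝ) j i)

/-- The Jacobian matrix of a vector field `f : ℝⁿ → ℝⁿ` at a point `x`. -/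
noncomputable def jacobian {n : ℕ} (f : (Fin n → ℝ) → (Fin n → ℝ)) (x : Fin n → ℝ) :
    Matrix (Fin n) (Fin n) ℝ :=
  Matrix.of fun i j => fderiv ℝ (fun y => f y i) x (Pi.single j 1)

section ColDet

variable {m : ℕ} (v : Fin m → Fin (m + 3) → ℝ)

lemma colDet_eq_detRowAlternating (w u₁ u₂ : Fin (m + 3) → ℝ) :
    colDet w v u₁ u₂ = Matrix.detRowAlternating
      (Fin.cons w (Fin.snoc (Fin.snoc v u₁) u₂) : Fin (m + 3) → Fin (m + 3) → ℝ) :=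
  Matrix.det_transpose (Matrix.of
    (Fin.cons w (Fin.snoc (Fin.snoc v u₁) u₂) : Fin (m + 3) → Fin (m + 3) → ℝ))

lemma colDet_eq_update_zero (w u₁ u₂ : Fin (m + 3) → ℝ) :
    colDet w v u₁ u₂ = Matrix.detRowAlternating
      (Function.update (Fin.cons 0 (Fin.snoc (Fin.snoc v u₁) u₂)) 0 w :
        Fin (m + 3) → Fin (m + 3) → ℝ) := by
  rw [Fin.update_cons_zero, colDet_eq_detRowAlternating]

lemma colDet_eq_update_last (w u₁ u₂ : Fin (m + 3) → ℝ) :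
    colDet w v u₁ u₂ = Matrix.detRowAlternating
      (Function.update (Fin.cons w (Fin.snoc (Fin.snoc v u₁) 0))
        (Fin.last (m + 1)).succ u₂ : Fin (m + 3) → Fin (m + 3) → ℝ) := by
  rw [← Fin.cons_update, Fin.update_snoc_last, colDet_eq_detRowAlternating]

lemma colDet_eq_update_penultimate (w u₁ u₂ : Fin (m + 3) → ℝ) :
    colDet w v u₁ u₂ = Matrix.detRowAlternating
      (Function.update (Fin.cons w (Fin.snoc (Fin.snoc v 0) u₂))
        (Fin.last m).castSucc.succ u₁ : Fin (m + 3) → Fin (m + 3) → ℝ) := by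
  rw [← Fin.cons_update, ← Fin.snoc_update, Fin.update_snoc_last,
    colDet_eq_detRowAlternating]

lemma colDet_add_smul_left (r s : ℝ) (w w' u₁ u₂ : Fin (m + 3) → ℝ) :
    colDet (r • w + s • w') v u₁ u₂ = r * colDet w v u₁ u₂ + s * colDet w' v u₁ u₂ := by
  simp only [colDet_eq_update_zero,
    AlternatingMap.map_update_add, AlternatingMap.map_update_smul, smul_eq_mul]

lemma colDet_add_smul_middle (r s : ℝ) (w u₁ u₁' u₂ : Fin (m + 3) → ℝ) :
    colDet w v (r • u₁ + s • u₁') u₂ = r * colDet w v u₁ u₂ + s * colDet w v u₁' u₂ := by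
  simp only [colDet_eq_update_penultimate,
    AlternatingMap.map_update_add, AlternatingMap.map_update_smul, smul_eq_mul]

lemma colDet_add_smul_right (r s : ℝ) (w u₁ u₂ u₂' : Fin (m + 3) → ℝ) :
    colDet w v u₁ (r • u₂ + s • u₂') = r * colDet w v u₁ u₂ + s * colDet w v u₁ u₂' := by
  simp only [colDet_eq_update_last,
    AlternatingMap.map_update_add, AlternatingMap.map_update_smul, smul_eq_mul]

lemma colDet_self_middle (w u : Fin (m + 3) → ℝ) : colDet w v w u = 0 := by
  rw [colDet_eq_detRowAlternating]
  refine AlternatingMap.map_eq_zero_of_eq _ _ (i := 0) (j := (Fin.last m).castSucc.succ) ?_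
    (Fin.succ_ne_zero _).symm
  simp only [Fin.cons_zero, Fin.cons_succ, Fin.snoc_castSucc, Fin.snoc_last]

lemma colDet_self_right (w u : Fin (m + 3) → ℝ) : colDet w v u w = 0 := by
  rw [colDet_eq_detRowAlternating]
  refine AlternatingMap.map_eq_zero_of_eq _ _ (i := 0) (j := (Fin.last (m + 1)).succ) ?_
    (Fin.succ_ne_zero _).symm
  simp only [Fin.cons_zero, Fin.cons_succ, Fin.snoc_last]

lemma colDet_swap_middle (w u₁ u₂ : Fin (m + 3) → ℝ) :
    colDet u₁ v w u₂ = -colDet w v u₁ u₂ := by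
  have h := colDet_self_middle v ((1 : ℝ) • w + (1 : ℝ) • u₁) u₂
  rw [colDet_add_smul_left, colDet_add_smul_middle, colDet_add_smul_middle, colDet_self_middle,
    colDet_self_middle] at h
  linarith

lemma colDet_swap_right (w u₁ u₂ : Fin (m + 3) → ℝ) :
    colDet u₂ v u₁ w = -colDet w v u₁ u₂ := by
  have h := colDet_self_right v ((1 : ℝ) • w + (1 : ℝ) • u₂) u₁
  rw [colDet_add_smul_left, colDet_add_smul_right, colDet_add_smul_right, colDet_self_right,
    colDet_self_right] at h
  linarith

/-- The vector representing the linear form `w ↦ colDet w v u₁ u₂`. -/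
def colCross (u₁ u₂ : Fin (m + 3) → ℝ) : Fin (m + 3) → ℝ :=
  fun i => colDet (Pi.single i 1) v u₁ u₂

lemma dotProduct_colCross (w u₁ u₂ : Fin (m + 3) → ℝ) :
    w ⬝ᵥ colCross v u₁ u₂ = colDet w v u₁ u₂ := by
  let L : (Fin (m + 3) → ℝ) →ₗ[ℝ] ℝ :=
    { toFun := fun w => colDet w v u₁ u₂
      map_add' := fun a b => by simpa using colDet_add_smul_left v 1 1 a b u₁ u₂
      map_smul' := fun r a => by simpa using colDet_add_smul_left v r 0 a 0 u₁ u₂ }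
  have h := L.pi_apply_eq_sum_univ w
  simp only [smul_eq_mul] at h
  refine Eq.trans ?_ h.symm
  refine Finset.sum_congr rfl fun i _ => ?_
  have hi : (Pi.single i 1 : Fin (m + 3) → ℝ) = fun j => if i = j then 1 else 0 := by
    funext j
    simp [Pi.single_apply, eq_comm]
  rw [← hi]
  rfl

end ColDet

lemma hasFDerivAt_dotProduct {n : ℕ} (a x : Fin n → ℝ) :
    HasFDerivAt (fun y => a ⬝ᵥ y)
      (LinearMap.toContinuousLinearMap (dotProductBilin ℝ ℝ a)) x :=
  (LinearMap.toContinuousLinearMap (dotProductBilin ℝ ℝ a)).hasFDerivAt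

lemma fderiv_dotProduct_mul_dotProduct_single {n : ℕ} (a b x : Fin n → ℝ) (j : Fin n) :
    fderiv ℝ (fun y => (a ⬝ᵥ y) * (b ⬝ᵥ y)) x (Pi.single j 1) =
      (a ⬝ᵥ x) * b j + (b ⬝ᵥ x) * a j := by
  rw [((hasFDerivAt_dotProduct a x).fun_mul (hasFDerivAt_dotProduct b x)).fderiv]
  simp

/-- The coefficient matrix of the Jacobian of the Nambu-type field with respect to the
linear forms `a₁, a₂, a₃, a₄`; its arguments `x₁, …, x₄` are the values of these forms. -/
def nambuCoeff {m : ℕ} (v : Fin m → Fin (m + 3) → ℝ) (a₁ a₂ a₃ a₄ : Fin (m + 3) → ℝ)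
    (x₁ x₂ x₃ x₄ : ℝ) : Matrix (Fin (m + 3)) (Fin 4) ℝ :=
  (Matrix.of ![x₄ • colCross v a₂ a₃ + x₃ • colCross v a₂ a₄,
    x₄ • colCross v a₁ a₃ + x₃ • colCross v a₁ a₄,
    x₂ • colCross v a₁ a₄ + x₁ • colCross v a₂ a₄,
    x₂ • colCross v a₁ a₃ + x₁ • colCross v a₂ a₃])ᵀ

lemma jacobian_eq_nambuCoeff_mul {m : ℕ} (v : Fin m → Fin (m + 3) → ℝ)
    (a₁ a₂ a₃ a₄ : Fin (m + 3) → ℝ) (f : (Fin (m + 3) → ℝ) → (Fin (m + 3) → ℝ))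
    (hf : ∀ w x : Fin (m + 3) → ℝ, w ⬝ᵥ f x =
      colDet w v ((a₂ ⬝ᵥ x) • a₁ + (a₁ ⬝ᵥ x) • a₂) ((a₄ ⬝ᵥ x) • a₃ + (a₃ ⬝ᵥ x) • a₄))
    (x : Fin (m + 3) → ℝ) :
    jacobian f x =
      nambuCoeff v a₁ a₂ a₃ a₄ (a₁ ⬝ᵥ x) (a₂ ⬝ᵥ x) (a₃ ⬝ᵥ x) (a₄ ⬝ᵥ x) *
        Matrix.of ![a₁, a₂, a₃, a₄] := by
  ext i j
  have hfi : (fun y => f y i) = fun y =>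
      (a₂ ⬝ᵥ y) * (a₄ ⬝ᵥ y) * colCross v a₁ a₃ i + (a₂ ⬝ᵥ y) * (a₃ ⬝ᵥ y) * colCross v a₁ a₄ i +
      (a₁ ⬝ᵥ y) * (a₄ ⬝ᵥ y) * colCross v a₂ a₃ i +
      (a₁ ⬝ᵥ y) * (a₃ ⬝ᵥ y) * colCross v a₂ a₄ i := by
    funext y
    have h := hf (Pi.single i 1) y
    rw [single_one_dotProduct, colDet_add_smul_middle, colDet_add_smul_right,
      colDet_add_smul_right] at h
    rw [h]
    simp only [colCross]
    ring
  have hd : ∀ a b : Fin (m + 3) → ℝ,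
      DifferentiableAt ℝ (fun y => (a ⬝ᵥ y) * (b ⬝ᵥ y)) x := fun a b =>
    ((hasFDerivAt_dotProduct a x).mul (hasFDerivAt_dotProduct b x)).differentiableAt
  have hs : ∀ (a b : Fin (m + 3) → ℝ) (c : ℝ),
      HasFDerivAt (fun y => (a ⬝ᵥ y) * (b ⬝ᵥ y) * c)
        (c • fderiv ℝ (fun y => (a ⬝ᵥ y) * (b ⬝ᵥ y)) x) x := fun a b c =>
    (hd a b).hasFDerivAt.mul_const c
  rw [jacobian, Matrix.of_apply, hfi,
    ((((hs a₂ a₄ _).fun_add (hs a₂ a₃ _)).fun_add (hs a₁ a₄ _)).fun_add (hs a₁ a₃ _)).fderiv]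
  simp only [_root_.add_apply, _root_.smul_apply, smul_eq_mul,
    fderiv_dotProduct_mul_dotProduct_single, Matrix.mul_apply, Fin.sum_univ_four, nambuCoeff]
  simp
  ring

/-- The determinant of `1 + ε f'`, where `P, Q, R, S` are the brackets
`[124], [123], [324], [314]` of the covectors. -/
lemma det_one_add_smul_nambuCoeff_mul {m : ℕ} (v : Fin m → Fin (m + 3) → ℝ)
    (a₁ a₂ a₃ a₄ : Fin (m + 3) → ℝ) (ε x₁ x₂ x₃ x₄ P Q R S : ℝ)
    (hP : P = ε * colDet a₁ v a₂ a₄) (hQ : Q = ε * colDet a₁ v a₂ a₃)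
    (hR : R = ε * colDet a₃ v a₂ a₄) (hS : S = ε * colDet a₃ v a₁ a₄) :
    (1 + ε • (nambuCoeff v a₁ a₂ a₃ a₄ x₁ x₂ x₃ x₄ * Matrix.of ![a₁, a₂, a₃, a₄])).det =
      (1 + (P * x₃ + Q * x₄)) * (1 - (P * x₃ + Q * x₄)) *
        ((1 + (R * x₁ + S * x₂)) * (1 - (R * x₁ + S * x₂))) -
      (P * x₃ * (1 - (R * x₁ + S * x₂)) - Q * x₄ * (1 + (R * x₁ + S * x₂))) *
        (R * x₁ * (1 - (P * x₃ + Q * x₄)) - S * x₂ * (1 + (P * x₃ + Q * x₄))) := by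
  have hM : (1 + ε • (Matrix.of ![a₁, a₂, a₃, a₄] * nambuCoeff v a₁ a₂ a₃ a₄ x₁ x₂ x₃ x₄)) =
      !![1 + (P * x₃ + Q * x₄), 0, P * x₁, Q * x₁;
        0, 1 - (P * x₃ + Q * x₄), -(P * x₂), -(Q * x₂);
        R * x₃, S * x₃, 1 + (R * x₁ + S * x₂), 0;
        -(R * x₄), -(S * x₄), 0, 1 - (R * x₁ + S * x₂)] := by
    have e : ∀ i k, (Matrix.of ![a₁, a₂, a₃, a₄] *
        nambuCoeff v a₁ a₂ a₃ a₄ x₁ x₂ x₃ x₄) i k =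
        ![a₁, a₂, a₃, a₄] i ⬝ᵥ ![x₄ • colCross v a₂ a₃ + x₃ • colCross v a₂ a₄,
          x₄ • colCross v a₁ a₃ + x₃ • colCross v a₁ a₄,
          x₂ • colCross v a₁ a₄ + x₁ • colCross v a₂ a₄,
          x₂ • colCross v a₁ a₃ + x₁ • colCross v a₂ a₃] k := fun i k => rfl
    have h214 := colDet_swap_middle v a₁ a₂ a₄
    have h213 := colDet_swap_middle v a₁ a₂ a₃
    have h423 := colDet_swap_right v a₃ a₂ a₄
    have h413 := colDet_swap_right v a₃ a₁ a₄
    ext i k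
    rw [Matrix.add_apply, Matrix.smul_apply, e]
    fin_cases i <;> fin_cases k <;>
      simp [dotProduct_add, dotProduct_smul, dotProduct_colCross, colDet_self_middle,
        colDet_self_right, h214, h213, h423, h413, hP, hQ, hR, hS] <;> ring
  rw [← Matrix.smul_mul, Matrix.det_one_add_mul_comm, Matrix.mul_smul, hM]
  simp [Matrix.det_succ_row_zero, Fin.sum_univ_succ, Fin.succAbove]
  ring

/-- The scalar form of the measure identity. Here `α, α'` and `β, β'` are the values at the two
points of the linear forms governing the Kahan–Hirota–Kimura relation. -/
lemma khk_scalar_identity {P Q R S x₁ x₂ x₃ x₄ y₁ y₂ y₃ y₄ α β α' β' : ℝ}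
    (h₁ : y₁ * (1 - α) = x₁ * (1 + α')) (h₂ : y₂ * (1 + α) = x₂ * (1 - α'))
    (h₃ : y₃ * (1 - β) = x₃ * (1 + β')) (h₄ : y₄ * (1 + β) = x₄ * (1 - β')) :
    ((1 + α') * (1 - α') * ((1 + β') * (1 - β')) -
        (P * y₃ * (1 - β') - Q * y₄ * (1 + β')) * (R * y₁ * (1 - α') - S * y₂ * (1 + α'))) *
        (x₁ * x₂ * x₃ * x₄) =
      ((1 + α) * (1 - α) * ((1 + β) * (1 - β)) -
        (P * x₃ * (1 + β) - Q * x₄ * (1 - β)) * (R * x₁ * (1 + α) - S * x₂ * (1 - α))) *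
        (y₁ * y₂ * y₃ * y₄) := by
  have e₁ : y₁ * (1 - α) * (y₂ * (1 + α)) * ((y₃ * (1 - β)) * (y₄ * (1 + β))) =
      x₁ * (1 + α') * (x₂ * (1 - α')) * ((x₃ * (1 + β')) * (x₄ * (1 - β'))) := by
    rw [h₁, h₂, h₃, h₄]
  have e₂ : P * (x₃ * y₃) * (y₄ * (1 + β)) - Q * (x₄ * y₄) * (y₃ * (1 - β)) =
      P * (x₃ * y₃) * (x₄ * (1 - β')) - Q * (x₄ * y₄) * (x₃ * (1 + β')) := by
    rw [h₃, h₄]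
  have e₃ : R * (x₁ * y₁) * (y₂ * (1 + α)) - S * (x₂ * y₂) * (y₁ * (1 - α)) =
      R * (x₁ * y₁) * (x₂ * (1 - α')) - S * (x₂ * y₂) * (x₁ * (1 + α')) := by
    rw [h₁, h₂]
  have e₄ := congrArg₂ (· * ·) e₂ e₃
  linear_combination e₄ - e₁

/-- for the Nambu-type vector field `f` with
`wᵀf(x) = det(w, v₁,…,v_{n−3}, ℓ₂a₁+ℓ₁a₂, ℓ₄a₃+ℓ₃a₄)`, any pair `x, x̃` satisfying
the Kahan–Hirota–Kimura relation fulfils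
`det(I+εf'(x̃)) ℓ₁(x)ℓ₂(x)ℓ₃(x)ℓ₄(x) = det(I−εf'(x)) ℓ₁(x̃)ℓ₂(x̃)ℓ₃(x̃)ℓ₄(x̃)`,
so the KHK map preserves the measure form `dx₁∧…∧dxₙ/(ℓ₁ℓ₂ℓ₃ℓ₄)`. -/
theorem khk_nambu_split_measure (m : ℕ) (a₁ a₂ a₃ a₄ : Fin (m + 3) → ℝ)
    (v : Fin m → Fin (m + 3) → ℝ)
    (ℓ₁ ℓ₂ ℓ₃ ℓ₄ : (Fin (m + 3) → ℝ) → ℝ)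
    (hℓ₁ : ℓ₁ = fun x => a₁ ⬝ᵥ x) (hℓ₂ : ℓ₂ = fun x => a₂ ⬝ᵥ x)
    (hℓ₃ : ℓ₃ = fun x => a₃ ⬝ᵥ x) (hℓ₄ : ℓ₄ = fun x => a₄ ⬝ᵥ x)
    (f : (Fin (m + 3) → ℝ) → (Fin (m + 3) → ℝ))
    (hf : ∀ (w x : Fin (m + 3) → ℝ),
      w ⬝ᵥ f x = colDet w v (ℓ₂ x • a₁ + ℓ₁ x • a₂) (ℓ₄ x • a₃ + ℓ₃ x • a₄))
    (ε : ℝ) (x x' : Fin (m + 3) → ℝ)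
    (hkhk : ∀ w : Fin (m + 3) → ℝ, w ⬝ᵥ (x' - x) =
      ε * ((ℓ₁ x * ℓ₃ x' + ℓ₁ x' * ℓ₃ x) * colDet w v a₂ a₄ +
           (ℓ₁ x * ℓ₄ x' + ℓ₁ x' * ℓ₄ x) * colDet w v a₂ a₃ +
           (ℓ₂ x * ℓ₃ x' + ℓ₂ x' * ℓ₃ x) * colDet w v a₁ a₄ +
           (ℓ₂ x * ℓ₄ x' + ℓ₂ x' * ℓ₄ x) * colDet w v a₁ a₃)) :
    (1 + ε • jacobian f x').det * (ℓ₁ x * ℓ₂ x * ℓ₃ x * ℓ₄ x) =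
      (1 - ε • jacobian f x).det * (ℓ₁ x' * ℓ₂ x' * ℓ₃ x' * ℓ₄ x') := by
  subst hℓ₁ hℓ₂ hℓ₃ hℓ₄
  have h₁ := hkhk a₁
  have h₂ := hkhk a₂
  have h₃ := hkhk a₃
  have h₄ := hkhk a₄
  simp only [dotProduct_sub, colDet_self_middle, colDet_self_right,
    colDet_swap_middle v a₁ a₂, colDet_swap_right v a₃ _ a₄] at h₁ h₂ h₃ h₄
  rw [sub_eq_add_neg, ← neg_smul, jacobian_eq_nambuCoeff_mul v a₁ a₂ a₃ a₄ f hf,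
    jacobian_eq_nambuCoeff_mul v a₁ a₂ a₃ a₄ f hf,
    det_one_add_smul_nambuCoeff_mul v a₁ a₂ a₃ a₄ ε _ _ _ _ _ _ _ _ rfl rfl rfl rfl,
    det_one_add_smul_nambuCoeff_mul v a₁ a₂ a₃ a₄ (-ε) _ _ _ _ _ _ _ _ rfl rfl rfl rfl]
  have key := khk_scalar_identity
    (P := ε * colDet a₁ v a₂ a₄) (Q := ε * colDet a₁ v a₂ a₃)
    (R := ε * colDet a₃ v a₂ a₄) (S := ε * colDet a₃ v a₁ a₄)
    (x₁ := a₁ ⬝ᵥ x) (x₂ := a₂ ⬝ᵥ x) (x₃ := a₃ ⬝ᵥ x) (x₄ := a₄ ⬝ᵥ x)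
    (y₁ := a₁ ⬝ᵥ x') (y₂ := a₂ ⬝ᵥ x') (y₃ := a₃ ⬝ᵥ x') (y₄ := a₄ ⬝ᵥ x')
    (α := ε * colDet a₁ v a₂ a₄ * (a₃ ⬝ᵥ x) + ε * colDet a₁ v a₂ a₃ * (a₄ ⬝ᵥ x))
    (β := ε * colDet a₃ v a₂ a₄ * (a₁ ⬝ᵥ x) + ε * colDet a₃ v a₁ a₄ * (a₂ ⬝ᵥ x))
    (α' := ε * colDet a₁ v a₂ a₄ * (a₃ ⬝ᵥ x') + ε * colDet a₁ v a₂ a₃ * (a₄ ⬝ᵥ x'))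
    (β' := ε * colDet a₃ v a₂ a₄ * (a₁ ⬝ᵥ x') + ε * colDet a₃ v a₁ a₄ * (a₂ ⬝ᵥ x'))
    (by linear_combination h₁) (by linear_combination h₂)
    (by linear_combination h₃) (by linear_combination h₄)
  linear_combination key
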